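/- For all positive integers n and m with 4 ≤ m ≤ n: u^(n,m,3) = min{u(n,m,3), 3m − 3 − gcd(n,m−1)} if gcd(n,m−1) ≥ 8; u^(n,m,3) = min{u(n,m,3), 3m − 10} if gcd(n,m−1) = 7, or if gcd(n,m−1) ≤ 5 and 3 | n and 3 | m; u^(n,m,3) = min{u(n,m,3), 3m − 9} if gcd(n,m−1) = 6; and u^(n,m,3) = min{u(n,m,3), 3m − 8} otherwise. Here u^(n,m,3) = min over positive divisors d of n of |3^A_d(n,m)|. -/

import Mathlib

open Finset

/-- The `h`-fold sumset of `A`: all sums of `h` not-necessarily-distinct elements of `A`. -/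
def hFoldSum {G : Type*} [AddCommMonoid G] [DecidableEq G] (h : ℕ) (A : Finset G) : Finset G :=
  (Fintype.piFinset fun _ : Fin h => A).image fun f => ∑ i, f i

/-- The `h`-fold restricted sumset of `A`: all sums of `h` pairwise distinct elements of `A`. -/
def hFoldRSum {G : Type*} [AddCommMonoid G] [DecidableEq G] (h : ℕ) (A : Finset G) : Finset G :=
  (A.powersetCard h).image fun s => ∑ x ∈ s, x

/-- `ρ(G,m,h)`: minimum size of the `h`-fold sumset over `m`-element subsets of `G`. -/
noncomputable def rho (G : Type*) [AddCommMonoid G] [DecidableEq G] (m h : ℕ) : ℕ :=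
  sInf { k | ∃ A : Finset G, A.card = m ∧ (hFoldSum h A).card = k }

/-- `ρ^(G,m,h)`: minimum size of the `h`-fold restricted sumset over `m`-element subsets. -/
noncomputable def rhoHat (G : Type*) [AddCommMonoid G] [DecidableEq G] (m h : ℕ) : ℕ :=
  sInf { k | ∃ A : Finset G, A.card = m ∧ (hFoldRSum h A).card = k }

/-- `f_d = (h⌈m/d⌉ - h + 1) d`. -/
def fd (m h d : ℕ) : ℕ := (h * ((m + d - 1) / d) - h + 1) * d

/-- `u(n,m,h) = min { f_d : d ∣ n, d > 0 }`. -/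
noncomputable def uFun (n m h : ℕ) : ℕ := sInf { k | ∃ d : ℕ, d ∣ n ∧ 0 < d ∧ k = fd m h d }

/-- The set `A_d(n,m) ⊆ ℤ_n`, with `c = ⌈m/d⌉ - 1`, `k = m - cd`,
`H = {j·(n/d) : j = 0,…,d-1}`:  `A_d(n,m) = ⋃_{i<c} (i+H) ∪ {c + j·(n/d) : j < k}`. -/
def Aset (n m d : ℕ) : Finset (ZMod n) :=
  ((Finset.range ((m + d - 1) / d - 1)) ×ˢ (Finset.range d)).image
    (fun p => (p.1 : ZMod n) + (p.2 : ZMod n) * ((n / d : ℕ) : ZMod n)) ∪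
  (Finset.range (m - ((m + d - 1) / d - 1) * d)).image
    (fun j : ℕ => (((m + d - 1) / d - 1 : ℕ) : ZMod n) + (j : ZMod n) * ((n / d : ℕ) : ZMod n))

/-- The set `B_d(n,m;k₁,k₂,g,j₀)` (with `c` such that `m = k₁ + (c-1)d + k₂`):
`{j·(n/d) : j < k₁} ∪ ⋃_{1 ≤ i ≤ c-1} (i·g + H) ∪ {c·g + (j₀+j)·(n/d) : j < k₂}`. -/
def Bset (n d k₁ k₂ c j₀ : ℕ) (g : ZMod n) : Finset (ZMod n) :=
  (Finset.range k₁).image (fun j : ℕ => (j : ZMod n) * ((n / d : ℕ) : ZMod n)) ∪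
  ((Finset.Ico 1 c) ×ˢ (Finset.range d)).image
    (fun p => p.1 • g + (p.2 : ZMod n) * ((n / d : ℕ) : ZMod n)) ∪
  (Finset.range k₂).image
    (fun j => c • g + ((j₀ + j : ℕ) : ZMod n) * ((n / d : ℕ) : ZMod n))

/-- `u^(n,m,h) = min { |h^A_d(n,m)| : d ∣ n, d > 0 }`. -/
noncomputable def uHat (n m h : ℕ) : ℕ :=
  sInf { k | ∃ d : ℕ, d ∣ n ∧ 0 < d ∧ k = (hFoldRSum h (Aset n m d)).card }

/-- The element `i + j q` of `ℤ_n`. -/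
def phi (n q i j : ℕ) : ZMod n := ((i + j * q : ℕ) : ZMod n)

theorem phi_eq_iff (n q i j i' j' : ℕ) :
    phi n q i j = phi n q i' j' ↔ (i + j * q) % n = (i' + j' * q) % n := by
  unfold phi
  rw [ZMod.natCast_eq_natCast_iff]
  rfl

theorem phi_mod {n q d : ℕ} (hn : n = q * d) (i j : ℕ) : phi n q i (j % d) = phi n q i j := by
  rw [phi_eq_iff]
  conv_rhs => rw [← Nat.div_add_mod j d]
  have : i + (d * (j / d) + j % d) * q = (i + j % d * q) + n * (j / d) := by
    subst hn; ring
  rw [this, Nat.add_mul_mod_self_left]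

theorem phi_add (n q i j a b : ℕ) : phi n q i j + phi n q a b = phi n q (i + a) (j + b) := by
  unfold phi
  push_cast
  ring

theorem phi_level {n q d : ℕ} (hn : n = q * d) {i j i' j' : ℕ}
    (h : phi n q i j = phi n q i' j') : i % q = i' % q := by
  rw [phi_eq_iff] at h
  have h2 : (i + j * q) % n % q = (i' + j' * q) % n % q := by rw [h]
  rw [Nat.mod_mod_of_dvd _ ⟨d, hn⟩, Nat.mod_mod_of_dvd _ ⟨d, hn⟩] at h2
  simpa using h2

theorem phi_inj {n q d : ℕ} (hn : n = q * d) (hq : 0 < q) {i j j' : ℕ}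
    (h : phi n q i j = phi n q i j') : j % d = j' % d := by
  rw [phi_eq_iff] at h
  have h2 : (j * q) ≡ (j' * q) [MOD n] := Nat.ModEq.add_left_cancel' i h
  rw [hn, mul_comm q d] at h2
  exact Nat.ModEq.mul_right_cancel' hq.ne' h2

theorem phi_ne {n q d : ℕ} (hn : n = q * d) {i j i' j' : ℕ} (hi : i < q) (hi' : i' < q)
    (h : i ≠ i') : phi n q i j ≠ phi n q i' j' := by
  intro e
  have := phi_level hn e
  rw [Nat.mod_eq_of_lt hi, Nat.mod_eq_of_lt hi'] at this
  exact h this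

theorem phi_surj {n q : ℕ} (h0 : 0 < n) (x : ZMod n) : ∃ i j, x = phi n q i j := by
  have : NeZero n := ⟨h0.ne'⟩
  exact ⟨x.val, 0, by simp [phi]⟩

theorem phi_shift {n q d : ℕ} (hd : 0 < d) (hn : n = q * d) (i j t : ℕ) (h : i % q = t % q) :
    ∃ j', phi n q i j = phi n q t j' := by
  refine ⟨j + i / q + (d - 1) * (t / q), ?_⟩
  rw [phi_eq_iff]
  have h1 := Nat.div_add_mod i q
  have h2 := Nat.div_add_mod t q
  obtain ⟨e, rfl⟩ : ∃ e, d = e + 1 := ⟨d - 1, by omega⟩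
  have : t + (j + i / q + (e + 1 - 1) * (t / q)) * q = (i + j * q) + n * (t / q) := by
    have h4 : (t : ℤ) = q * (t / q : ℕ) + (t % q : ℕ) := by exact_mod_cast h2.symm
    have h3 : (i : ℤ) = q * (i / q : ℕ) + (t % q : ℕ) := by rw [← h]; exact_mod_cast h1.symm
    generalize t / q = u at *
    generalize i / q = v at *
    generalize t % q = w at *
    rw [hn]
    zify
    simp only [Nat.add_sub_cancel]
    rw [h3, h4]
    ring
  rw [this, Nat.add_mul_mod_self_left]

theorem mem_A {n m d q : ℕ} (hd : 0 < d) (hn : n = q * d) (hm : 0 < m) (x : ZMod n) :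
    x ∈ Aset n m d ↔ ∃ i j, j < d ∧ i * d + j < m ∧ x = phi n q i j := by
  have hq : n / d = q := by rw [hn]; exact Nat.mul_div_cancel _ hd
  obtain ⟨c, k, hk1, hkd, hmk⟩ : ∃ c k, 1 ≤ k ∧ k ≤ d ∧ m = c * d + k := by
    refine ⟨(m - 1) / d, (m - 1) % d + 1, by omega, Nat.mod_lt _ hd, ?_⟩
    have := Nat.div_add_mod (m - 1) d
    rw [mul_comm]; omega
  have hc : (m + d - 1) / d - 1 = c := by
    have : (m + d - 1) / d = c + 1 := by
      have e : m + d - 1 = (k - 1) + d * (c + 1) := by rw [hmk, mul_add, mul_comm d c]; omega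
      rw [e, Nat.add_mul_div_left _ _ hd, Nat.div_eq_of_lt (by omega)]; omega
    omega
  unfold Aset phi
  rw [hq, hc]
  have hk' : m - c * d = k := by omega
  rw [hk']
  simp only [mem_union, mem_image, mem_product, mem_range, Prod.exists]
  constructor
  · rintro (⟨i, j, ⟨hi, hj⟩, rfl⟩ | ⟨j, hj, rfl⟩)
    · refine ⟨i, j, hj, ?_, by push_cast; ring⟩
      have : (i + 1) * d ≤ c * d := Nat.mul_le_mul_right _ hi
      rw [add_mul] at this
      omega
    · exact ⟨c, j, by omega, by omega, by push_cast; ring⟩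
  · rintro ⟨i, j, hj, hij, rfl⟩
    rcases lt_trichotomy i c with h | h | h
    · exact Or.inl ⟨i, j, ⟨h, hj⟩, by push_cast; ring⟩
    · subst h
      exact Or.inr ⟨j, by omega, by push_cast; ring⟩
    · have : (c + 1) * d ≤ i * d := Nat.mul_le_mul_right _ h
      rw [add_mul] at this
      omega

theorem mem_R {G : Type*} [AddCommMonoid G] [DecidableEq G] (A : Finset G) (x : G) :
    x ∈ hFoldRSum 3 A ↔ ∃ a ∈ A, ∃ b ∈ A, ∃ c ∈ A, a ≠ b ∧ a ≠ c ∧ b ≠ c ∧ x = a + b + c := by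
  unfold hFoldRSum
  simp only [mem_image, mem_powersetCard]
  constructor
  · rintro ⟨s, ⟨hs, hc⟩, rfl⟩
    obtain ⟨a, b, c, hab, hac, hbc, rfl⟩ := Finset.card_eq_three.1 hc
    refine ⟨a, hs (by simp), b, hs (by simp), c, hs (by simp), hab, hac, hbc, ?_⟩
    rw [sum_insert (by simp [hab, hac]), sum_insert (by simp [hbc]), sum_singleton, add_assoc]
  · rintro ⟨a, ha, b, hb, c, hc, hab, hac, hbc, rfl⟩
    refine ⟨{a, b, c}, ⟨?_, Finset.card_eq_three.2 ⟨a, b, c, hab, hac, hbc, rfl⟩⟩, ?_⟩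
    · intro y hy
      simp only [mem_insert, mem_singleton] at hy
      rcases hy with rfl | rfl | rfl <;> assumption
    · rw [sum_insert (by simp [hab, hac]), sum_insert (by simp [hbc]), sum_singleton, add_assoc]

theorem three (c t : ℕ) (h1 : 3 ≤ t) (h2 : t + 3 ≤ 3 * c) :
    ∃ a b e, a < b ∧ b < e ∧ e ≤ c ∧ a + b + e = t := by
  rcases Nat.lt_or_ge (c + 1) t with h | h
  · rcases Nat.lt_or_ge (t - c) c with h' | h'
    · exact ⟨0, t - c, c, by omega, by omega, by omega, by omega⟩
    · exact ⟨t - c - (c - 1), c - 1, c, by omega, by omega, by omega, by omega⟩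
  · exact ⟨0, 1, t - 1, by omega, by omega, by omega, by omega⟩

theorem mod_add_ne {q a b : ℕ} (h : a < b) (h2 : b < a + q) : a % q ≠ b % q := by
  intro e
  have : q ∣ b - a := (Nat.modEq_iff_dvd' h.le).1 e
  have := Nat.le_of_dvd (by omega) this
  omega

theorem lower_gen {n q d : ℕ} (hd : 0 < d) (hq : 0 < q) (hn : n = q * d) (X E : Finset (ZMod n))
    (t0 T : ℕ) (hX : ∀ t j, t0 ≤ t → t < t0 + T → phi n q t j ∈ X) (hE : E ⊆ X)
    (hE2 : ∀ x ∈ E, ∃ j, x = phi n q (t0 + T) j ∨ (1 ≤ t0 ∧ x = phi n q (t0 - 1) j)) :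
    n ≤ X.card ∨ T * d + E.card ≤ X.card := by
  have h0 : 0 < n := by rw [hn]; positivity
  have : NeZero n := ⟨h0.ne'⟩
  rcases Nat.lt_or_ge T q with hT | hT
  · right
    let P := (Ico t0 (t0 + T) ×ˢ range d).image (fun p => phi n q p.1 p.2)
    have hP : P.card = T * d := by
      rw [card_image_of_injOn]
      · simp
      · rintro ⟨t, j⟩ h ⟨t', j'⟩ h' e
        simp only [coe_product, Set.mem_prod, mem_coe, mem_Ico, mem_range] at h h'
        simp only at e
        have e1 := phi_level hn e
        have ht : t = t' := by
          rcases lt_trichotomy t t' with g | g | g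
          · exact absurd e1 (mod_add_ne g (by omega))
          · exact g
          · exact absurd e1.symm (mod_add_ne g (by omega))
        subst ht
        have := phi_inj hn hq e
        rw [Nat.mod_eq_of_lt h.2, Nat.mod_eq_of_lt h'.2] at this
        rw [this]
    have hdis : Disjoint P E := by
      rw [Finset.disjoint_left]
      intro x hx hxE
      simp only [P, mem_image, mem_product, mem_Ico, mem_range, Prod.exists] at hx
      obtain ⟨t, j, ⟨⟨ht1, ht2⟩, hj⟩, rfl⟩ := hx
      obtain ⟨j', h | ⟨h1, h⟩⟩ := hE2 _ hxE
      · exact mod_add_ne (by omega) (by omega) (phi_level hn h)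
      · exact mod_add_ne (by omega) (by omega) (phi_level hn h).symm
    rw [← hP, ← card_union_of_disjoint hdis]
    apply card_le_card
    apply union_subset _ hE
    intro x hx
    simp only [P, mem_image, mem_product, mem_Ico, mem_range, Prod.exists] at hx
    obtain ⟨t, j, ⟨⟨ht1, ht2⟩, hj⟩, rfl⟩ := hx
    exact hX t j ht1 ht2
  · left
    have : X = univ := by
      ext x
      simp only [mem_univ, iff_true]
      obtain ⟨i, j, rfl⟩ := phi_surj (q := q) h0 x
      -- find t in the window congruent to i
      have hmod := Nat.mod_lt (i + (q - 1) * t0) hq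
      obtain ⟨j', hj'⟩ := phi_shift hd hn i j (t0 + (i + (q - 1) * t0) % q) (by
        rw [Nat.add_mod_mod]
        obtain ⟨p, rfl⟩ : ∃ p, q = p + 1 := ⟨q - 1, by omega⟩
        have : t0 + (i + (p + 1 - 1) * t0) = i + (p + 1) * t0 := by
          simp only [Nat.add_sub_cancel]; ring
        rw [this, Nat.add_mul_mod_self_left])
      rw [hj']
      exact hX _ _ (by omega) (by omega)
    rw [this, card_univ, ZMod.card]

theorem upper_gen {n q d : ℕ} (hn : n = q * d) (hd : 0 < d) (X E : Finset (ZMod n)) (t0 T : ℕ)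
    (hX : ∀ x ∈ X, x ∈ E ∨ ∃ t j, t0 ≤ t ∧ t < t0 + T ∧ x = phi n q t j) :
    X.card ≤ T * d + E.card := by
  let P := (Ico t0 (t0 + T) ×ˢ range d).image (fun p => phi n q p.1 p.2)
  have hP : P.card ≤ T * d := by
    refine card_image_le.trans ?_
    simp
  have : X ⊆ P ∪ E := by
    intro x hx
    rcases hX x hx with h | ⟨t, j, h1, h2, rfl⟩
    · exact mem_union_right _ h
    · apply mem_union_left
      simp only [P, mem_image, mem_product, mem_Ico, mem_range, Prod.exists]
      exact ⟨t, j % d, ⟨⟨h1, h2⟩, Nat.mod_lt _ hd⟩, phi_mod hn t j⟩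
  have h1 := card_le_card this
  have h2 := card_union_le P E
  omega

/-- Data: `A ⊆ ℤ_n` described by `c` and `k`. -/
theorem A_props {n m d q c k : ℕ} (hd : 0 < d) (hn : n = q * d) (hmn : m ≤ n)
    (hk1 : 1 ≤ k) (hkd : k ≤ d) (hmk : m = c * d + k) :
    c < q ∧ (∀ i j, i < c → phi n q i j ∈ Aset n m d) ∧
    (∀ j, j < k → phi n q c j ∈ Aset n m d) ∧
    (k = d → ∀ j, phi n q c j ∈ Aset n m d) ∧
    (∀ x ∈ Aset n m d, ∃ i j, j < d ∧ i ≤ c ∧ (i = c → j < k) ∧ x = phi n q i j) := by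
  have h3 : ∀ j, j < k → phi n q c j ∈ Aset n m d := by
    intro j hj
    rw [mem_A hd hn (by omega)]
    exact ⟨c, j, by omega, by omega, rfl⟩
  refine ⟨?_, ?_, h3, ?_, ?_⟩
  · by_contra h
    have : q * d ≤ c * d := Nat.mul_le_mul_right _ (by omega)
    omega
  · intro i j hi
    rw [mem_A hd hn (by omega)]
    refine ⟨i, j % d, Nat.mod_lt _ hd, ?_, (phi_mod hn i j).symm⟩
    have : (i + 1) * d ≤ c * d := Nat.mul_le_mul_right _ hi
    have := Nat.mod_lt j hd
    rw [add_mul] at *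
    omega
  · intro hk j
    rw [← phi_mod hn]
    exact h3 _ ((Nat.mod_lt j hd).trans_eq hk.symm)
  · intro x hx
    rw [mem_A hd hn (by omega)] at hx
    obtain ⟨i, j, hj, hij, rfl⟩ := hx
    have hic : i ≤ c := by
      by_contra h
      have : (c + 1) * d ≤ i * d := Nat.mul_le_mul_right _ (by omega)
      rw [add_mul] at this
      omega
    refine ⟨i, j, hj, hic, ?_, rfl⟩
    rintro rfl
    omega

theorem mem_sum {n q : ℕ} {A : Finset (ZMod n)} {a b e x y z t j : ℕ}
    (ha : phi n q a x ∈ A) (hb : phi n q b y ∈ A) (he : phi n q e z ∈ A)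
    (h1 : phi n q a x ≠ phi n q b y) (h2 : phi n q a x ≠ phi n q e z)
    (h3 : phi n q b y ≠ phi n q e z) (ht : t = a + b + e)
    (hj : phi n q t j = phi n q t (x + y + z)) :
    phi n q t j ∈ hFoldRSum 3 A := by
  rw [mem_R]
  refine ⟨_, ha, _, hb, _, he, h1, h2, h3, ?_⟩
  rw [phi_add, phi_add, hj, ht]

theorem phi_ne2 {n q d : ℕ} (hn : n = q * d) (hq : 0 < q) {i j j' : ℕ} (h : j < d) (h' : j' < d)
    (hne : j ≠ j') : phi n q i j ≠ phi n q i j' := by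
  intro e
  have := phi_inj hn hq e
  rw [Nat.mod_eq_of_lt h, Nat.mod_eq_of_lt h'] at this
  exact hne this

/-- levels `3..3c-3` are full -/
theorem full_mid {n d q c : ℕ} (hd : 0 < d) (hn : n = q * d) {A : Finset (ZMod n)} (hcq : c < q)
    (hA : ∀ i j, i < c → phi n q i j ∈ A) (hc : phi n q c 0 ∈ A)
    (t j : ℕ) (h1 : 3 ≤ t) (h2 : t + 3 ≤ 3 * c) : phi n q t j ∈ hFoldRSum 3 A := by
  obtain ⟨a, b, e, hab, hbe, hec, rfl⟩ := three c t h1 h2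
  have he : phi n q e 0 ∈ A := by
    rcases Nat.lt_or_ge e c with h | h
    · exact hA _ _ h
    · obtain rfl : e = c := by omega
      exact hc
  exact mem_sum (hA a j (by omega)) (hA b 0 (by omega)) he
    (phi_ne hn (by omega) (by omega) (by omega)) (phi_ne hn (by omega) (by omega) (by omega))
    (phi_ne hn (by omega) (by omega) (by omega)) rfl rfl

theorem full_one {n d q c : ℕ} (hd : 2 ≤ d) (hn : n = q * d) {A : Finset (ZMod n)} (hcq : c < q)
    (hA : ∀ i j, i < c → phi n q i j ∈ A) (hc2 : 2 ≤ c) (j : ℕ) :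
    phi n q 1 j ∈ hFoldRSum 3 A := by
  refine mem_sum (hA 0 0 (by omega)) (hA 0 1 (by omega)) (hA 1 (j + (d - 1)) (by omega))
    (phi_ne2 hn (by omega) (by omega) (by omega) (by omega))
    (phi_ne hn (by omega) (by omega) (by omega)) (phi_ne hn (by omega) (by omega) (by omega))
    rfl ?_
  rw [← phi_mod hn, ← phi_mod hn _ (0 + 1 + (j + (d - 1)))]
  rw [show 0 + 1 + (j + (d - 1)) = j + d by omega, Nat.add_mod_right]

theorem full_two {n d q c : ℕ} (hd : 2 ≤ d) (hn : n = q * d) {A : Finset (ZMod n)} (hcq : c < q)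
    (hA : ∀ i j, i < c → phi n q i j ∈ A) (hc2 : 2 ≤ c) (j : ℕ) :
    phi n q 2 j ∈ hFoldRSum 3 A := by
  refine mem_sum (hA 1 0 (by omega)) (hA 1 1 (by omega)) (hA 0 (j + (d - 1)) (by omega))
    (phi_ne2 hn (by omega) (by omega) (by omega) (by omega))
    (phi_ne hn (by omega) (by omega) (by omega)) (phi_ne hn (by omega) (by omega) (by omega))
    rfl ?_
  rw [← phi_mod hn, ← phi_mod hn _ (0 + 1 + (j + (d - 1)))]
  rw [show 0 + 1 + (j + (d - 1)) = j + d by omega, Nat.add_mod_right]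

/-- level `3c-1` is full when `k ≥ 2` -/
theorem full_top1 {n d q c : ℕ} (hd : 2 ≤ d) (hn : n = q * d) {A : Finset (ZMod n)} (hcq : c < q)
    (hA : ∀ i j, i < c → phi n q i j ∈ A) (hc1 : 1 ≤ c) (h0 : phi n q c 0 ∈ A)
    (h1 : phi n q c 1 ∈ A) (j : ℕ) :
    phi n q (3 * c - 1) j ∈ hFoldRSum 3 A := by
  refine mem_sum h0 h1 (hA (c - 1) (j + (d - 1)) (by omega))
    (phi_ne2 hn (by omega) (by omega) (by omega) (by omega))
    (phi_ne hn (by omega) (by omega) (by omega)) (phi_ne hn (by omega) (by omega) (by omega))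
    (by omega) ?_
  rw [← phi_mod hn, ← phi_mod hn _ (0 + 1 + (j + (d - 1)))]
  rw [show 0 + 1 + (j + (d - 1)) = j + d by omega, Nat.add_mod_right]

/-- level `3c-2` is full when `d ≥ 3` -/
theorem full_top2 {n d q c : ℕ} (hd : 3 ≤ d) (hn : n = q * d) {A : Finset (ZMod n)} (hcq : c < q)
    (hA : ∀ i j, i < c → phi n q i j ∈ A) (hc1 : 1 ≤ c) (h0 : phi n q c 0 ∈ A) (j : ℕ) :
    phi n q (3 * c - 2) j ∈ hFoldRSum 3 A := by
  rw [← phi_mod hn]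
  have hj := Nat.mod_lt j (show 0 < d by omega)
  generalize j % d = r at *
  by_cases hr : r = 0
  · subst hr
    refine mem_sum (hA (c - 1) 1 (by omega)) (hA (c - 1) (d - 1) (by omega)) h0
      (phi_ne2 hn (by omega) (by omega) (by omega) (by omega))
      (phi_ne hn (by omega) (by omega) (by omega)) (phi_ne hn (by omega) (by omega) (by omega))
      (by omega) ?_
    rw [← phi_mod hn _ (1 + (d - 1) + 0)]
    rw [show 1 + (d - 1) + 0 = d by omega, Nat.mod_self]
  · exact mem_sum (hA (c - 1) 0 (by omega)) (hA (c - 1) r (by omega)) h0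
      (phi_ne2 hn (by omega) (by omega) (by omega) (by omega))
      (phi_ne hn (by omega) (by omega) (by omega)) (phi_ne hn (by omega) (by omega) (by omega))
      (by omega) (by simp)

/-- level `3c-2` is full when `c ≥ 2`, `k ≥ 2` -/
theorem full_top2' {n d q c : ℕ} (hd : 2 ≤ d) (hn : n = q * d) {A : Finset (ZMod n)} (hcq : c < q)
    (hA : ∀ i j, i < c → phi n q i j ∈ A) (hc1 : 2 ≤ c) (h0 : phi n q c 0 ∈ A)
    (h1 : phi n q c 1 ∈ A) (j : ℕ) :
    phi n q (3 * c - 2) j ∈ hFoldRSum 3 A := by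
  refine mem_sum h0 h1 (hA (c - 2) (j + (d - 1)) (by omega))
    (phi_ne2 hn (by omega) (by omega) (by omega) (by omega))
    (phi_ne hn (by omega) (by omega) (by omega)) (phi_ne hn (by omega) (by omega) (by omega))
    (by omega) ?_
  rw [← phi_mod hn, ← phi_mod hn _ (0 + 1 + (j + (d - 1)))]
  rw [show 0 + 1 + (j + (d - 1)) = j + d by omega, Nat.add_mod_right]

theorem full_zero {n d q c : ℕ} (hd : 4 ≤ d) (hn : n = q * d) {A : Finset (ZMod n)} (hcq : c < q)
    (hA : ∀ i j, i < c → phi n q i j ∈ A) (hc1 : 1 ≤ c) (j : ℕ) :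
    phi n q 0 j ∈ hFoldRSum 3 A := by
  rw [← phi_mod hn]
  have hj := Nat.mod_lt j (show 0 < d by omega)
  generalize j % d = r at *
  have key : ∀ x y z, x < d → y < d → z < d → x ≠ y → x ≠ z → y ≠ z →
      (x + y + z = r ∨ x + y + z = r + d) → phi n q 0 r ∈ hFoldRSum 3 A := by
    intro x y z hx hy hz h1 h2 h3 h
    refine mem_sum (hA 0 x (by omega)) (hA 0 y (by omega)) (hA 0 z (by omega))
      (phi_ne2 hn (by omega) hx hy h1) (phi_ne2 hn (by omega) hx hz h2)
      (phi_ne2 hn (by omega) hy hz h3) rfl ?_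
    rcases h with h | h
    · rw [h]
    · rw [h, ← phi_mod hn, ← phi_mod hn _ (r + d), Nat.add_mod_right]
  by_cases h0 : r = 0
  · exact key 0 1 (d - 1) (by omega) (by omega) (by omega) (by omega) (by omega) (by omega)
      (by omega)
  by_cases h1 : r = 1
  · exact key 0 2 (d - 1) (by omega) (by omega) (by omega) (by omega) (by omega) (by omega)
      (by omega)
  by_cases h2 : r = 2
  · exact key 1 2 (d - 1) (by omega) (by omega) (by omega) (by omega) (by omega) (by omega)
      (by omega)
  exact key 0 1 (r - 1) (by omega) (by omega) (by omega) (by omega) (by omega) (by omega)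
      (by omega)

/-- the top level: at least `min (d, 3k-8)` elements -/
theorem top_level {n d q c k : ℕ} (hn : n = q * d) {A : Finset (ZMod n)} (hcq : c < q)
    (hA : ∀ j, j < k → phi n q c j ∈ A) (hkd : k ≤ d) :
    ∃ E ⊆ hFoldRSum 3 A, E.card = min d (3 * k - 8) ∧ ∀ x ∈ E, ∃ j, x = phi n q (3 * c) j := by
  refine ⟨(Ico 3 (3 + min d (3 * k - 8))).image (fun j => phi n q (3 * c) j), ?_, ?_, ?_⟩
  · intro x hx
    simp only [mem_image, mem_Ico] at hx
    obtain ⟨j, ⟨h1, h2⟩, rfl⟩ := hx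
    obtain ⟨a, b, e, hab, hbe, hek, rfl⟩ := three (k - 1) j h1 (by omega)
    exact mem_sum (hA a (by omega)) (hA b (by omega)) (hA e (by omega))
      (phi_ne2 hn (by omega) (by omega) (by omega) (by omega))
      (phi_ne2 hn (by omega) (by omega) (by omega) (by omega))
      (phi_ne2 hn (by omega) (by omega) (by omega) (by omega)) (by omega) rfl
  · rw [card_image_of_injOn]
    · simp
    · intro j hj j' hj' e
      simp only [coe_Ico, Set.mem_Ico] at hj hj'
      have e1 := phi_inj hn (by omega) e
      rcases lt_trichotomy j j' with g | g | g
      · exact absurd e1 (mod_add_ne g (by omega))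
      · exact g
      · exact absurd e1.symm (mod_add_ne g (by omega))
  · intro x hx
    simp only [mem_image, mem_Ico] at hx
    obtain ⟨j, ⟨h1, h2⟩, rfl⟩ := hx
    exact ⟨j, rfl⟩

theorem fd_eq {m d c k : ℕ} (hk1 : 1 ≤ k) (hkd : k ≤ d) (hmk : m = c * d + k) :
    fd m 3 d = (3 * c + 1) * d := by
  have hd : 0 < d := by omega
  unfold fd
  have : (m + d - 1) / d = c + 1 := by
    have e : m + d - 1 = (k - 1) + d * (c + 1) := by rw [hmk, mul_add, mul_comm d c]; omega
    rw [e, Nat.add_mul_div_left _ _ hd, Nat.div_eq_of_lt (by omega)]; omega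
  rw [this]
  congr 1

theorem exists_ck (m d : ℕ) (hd : 0 < d) (hm : 0 < m) :
    ∃ c k, 1 ≤ k ∧ k ≤ d ∧ m = c * d + k := by
  refine ⟨(m - 1) / d, (m - 1) % d + 1, by omega, Nat.mod_lt _ hd, ?_⟩
  have := Nat.div_add_mod (m - 1) d
  rw [mul_comm]; omega

theorem lower_main {n m d q : ℕ} (hd : 0 < d) (hn : n = q * d) (hm : 4 ≤ m) (hmn : m ≤ n) :
    n ≤ (hFoldRSum 3 (Aset n m d)).card ∨ fd m 3 d ≤ (hFoldRSum 3 (Aset n m d)).card ∨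
    3 * m - 8 ≤ (hFoldRSum 3 (Aset n m d)).card ∨
    (d = 3 ∧ 3 ∣ m ∧ 3 * m - 10 ≤ (hFoldRSum 3 (Aset n m d)).card) ∨
    (d ∣ m - 1 ∧ 3 * m - 3 - d ≤ (hFoldRSum 3 (Aset n m d)).card) := by
  obtain ⟨c, k, hk1, hkd, hmk⟩ := exists_ck m d hd (by omega)
  obtain ⟨hcq, hA, hAc, hAd, -⟩ := A_props hd hn hmn hk1 hkd hmk
  rw [fd_eq hk1 hkd hmk]
  have hq : 0 < q := by omega
  have gen := lower_gen hd hq hn (hFoldRSum 3 (Aset n m d))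
  have mid := full_mid hd hn hcq hA (hAc 0 (by omega))
  generalize hS : hFoldRSum 3 (Aset n m d) = S at *
  obtain hd1 | hd2 | hd3 | hd4 : d = 1 ∨ d = 2 ∨ d = 3 ∨ 4 ≤ d := by omega
  · -- d = 1
    subst hd1
    have := gen ∅ 3 (3 * m - 8) (fun t j h1 h2 => mid t j h1 (by omega)) (by simp) (by simp)
    simp only [card_empty, add_zero, mul_one] at this
    omega
  · subst hd2
    obtain hk | hk : k = 1 ∨ k = 2 := by omega
    · subst hk
      have hx : phi n q (3 * c - 2) 1 ∈ S := by
        rw [← hS]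
        exact mem_sum (hA (c - 1) 0 (by omega)) (hA (c - 1) 1 (by omega)) (hAc 0 (by omega))
          (phi_ne2 hn (by omega) (by omega) (by omega) (by omega))
          (phi_ne hn (by omega) (by omega) (by omega))
          (phi_ne hn (by omega) (by omega) (by omega)) (by omega) rfl
      have := gen {phi n q (3 * c - 2) 1} 1 (3 * c - 3) (fun t j h1 h2 => by
          obtain h | h | h : t = 1 ∨ t = 2 ∨ 3 ≤ t := by omega
          · rw [h, ← hS]; exact full_one (by omega) hn hcq hA (by omega) j
          · rw [h, ← hS]; exact full_two (by omega) hn hcq hA (by omega) j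
          · exact mid t j h (by omega)) (by simpa using hx) (by
          intro x hx
          rw [mem_singleton] at hx
          refine ⟨1, Or.inl ?_⟩
          rw [hx]; congr 1; omega)
      simp only [card_singleton] at this
      omega
    · subst hk
      have := gen ∅ 1 (3 * c - 1) (fun t j h1 h2 => by
          by_cases ht : t = 3 * c - 1
          · rw [ht, ← hS]
            exact full_top1 (by omega) hn hcq hA (by omega) (hAc 0 (by omega))
              (hAc 1 (by omega)) j
          by_cases ht2 : t = 3 * c - 2
          · by_cases hc : c = 1
            · subst hc
              obtain rfl : t = 1 := by omega
              rw [← hS]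
              refine mem_sum (hA 0 0 (by omega)) (hA 0 1 (by omega)) (hAd rfl (j + 1))
                (phi_ne2 hn (by omega) (by omega) (by omega) (by omega))
                (phi_ne hn (by omega) (by omega) (by omega))
                (phi_ne hn (by omega) (by omega) (by omega)) (by omega) ?_
              rw [← phi_mod hn, ← phi_mod hn _ (0 + 1 + (j + 1))]
              rw [show 0 + 1 + (j + 1) = j + 2 by omega, Nat.add_mod_right]
            · rw [ht2, ← hS]
              exact full_top2' (by omega) hn hcq hA (by omega) (hAc 0 (by omega))
                (hAc 1 (by omega)) j
          obtain h | h | h : t = 1 ∨ t = 2 ∨ 3 ≤ t := by omega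
          · rw [h, ← hS]; exact full_one (by omega) hn hcq hA (by omega) j
          · rw [h, ← hS]; exact full_two (by omega) hn hcq hA (by omega) j
          · exact mid t j h (by omega)) (by simp) (by simp)
      simp only [card_empty] at this
      omega
  · subst hd3
    have hc1 : 1 ≤ c := by omega
    have h0 : phi n q 0 3 ∈ S := by
      rw [← hS]
      exact mem_sum (hA 0 0 (by omega)) (hA 0 1 (by omega)) (hA 0 2 (by omega))
          (phi_ne2 hn (by omega) (by omega) (by omega) (by omega))
          (phi_ne2 hn (by omega) (by omega) (by omega) (by omega))
          (phi_ne2 hn (by omega) (by omega) (by omega) (by omega)) (by omega) rfl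
    have F : ∀ t j, 1 ≤ t → t + 2 ≤ 3 * c → phi n q t j ∈ S := by
      intro t j h1 h2
      by_cases ht2 : t = 3 * c - 2
      · rw [ht2, ← hS]
        exact full_top2 (by omega) hn hcq hA (by omega) (hAc 0 (by omega)) j
      obtain h | h | h : t = 1 ∨ t = 2 ∨ 3 ≤ t := by omega
      · rw [h, ← hS]; exact full_one (by omega) hn hcq hA (by omega) j
      · rw [h, ← hS]; exact full_two (by omega) hn hcq hA (by omega) j
      · exact mid t j h (by omega)
    by_cases hk : k = 1
    · have := gen {phi n q 0 3} 1 (3 * c - 2) (fun t j h1 h2 => F t j h1 (by omega))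
        (by simpa using h0) (by
          intro x hx
          rw [mem_singleton] at hx
          exact ⟨3, Or.inr ⟨le_rfl, hx⟩⟩)
      simp only [card_singleton] at this
      omega
    have F' : ∀ t j, 1 ≤ t → t < 1 + (3 * c - 1) → phi n q t j ∈ S := by
      intro t j h1 h2
      by_cases ht2 : t = 3 * c - 1
      · rw [ht2, ← hS]
        exact full_top1 (by omega) hn hcq hA (by omega) (hAc 0 (by omega)) (hAc 1 (by omega)) j
      · exact F t j h1 (by omega)
    by_cases hk2 : k = 2
    · have := gen {phi n q 0 3} 1 (3 * c - 1) F'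
        (by simpa using h0) (by
          intro x hx
          rw [mem_singleton] at hx
          exact ⟨3, Or.inr ⟨le_rfl, hx⟩⟩)
      simp only [card_singleton] at this
      omega
    · obtain rfl : k = 3 := by omega
      have h3 : phi n q (3 * c) 3 ∈ S := by
        rw [← hS]
        exact mem_sum (hAc 0 (by omega)) (hAc 1 (by omega)) (hAc 2 (by omega))
          (phi_ne2 hn (by omega) (by omega) (by omega) (by omega))
          (phi_ne2 hn (by omega) (by omega) (by omega) (by omega))
          (phi_ne2 hn (by omega) (by omega) (by omega) (by omega)) (by omega) rfl
      have hne : phi n q 0 3 ≠ phi n q (3 * c) 3 := by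
        intro e
        rw [phi_eq_iff] at e
        exact mod_add_ne (by omega) (by omega) e
      have := gen {phi n q 0 3, phi n q (3 * c) 3} 1 (3 * c - 1) F'
        (by
          intro x hx
          simp only [mem_insert, mem_singleton] at hx
          rcases hx with rfl | rfl <;> assumption) (by
          intro x hx
          simp only [mem_insert, mem_singleton] at hx
          rcases hx with rfl | rfl
          · exact ⟨3, Or.inr ⟨le_rfl, rfl⟩⟩
          · exact ⟨3, Or.inl (by congr 1; omega)⟩)
      rw [card_pair hne] at this
      omega
  · -- d ≥ 4
    have hfd : (3 * c + 1) * d = 3 * (c * d) + d := by ring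
    obtain ⟨E, hES, hEc, hE⟩ := top_level hn hcq hAc hkd
    rw [hS] at hES
    by_cases hc0 : c = 0
    · subst hc0
      have := gen E 0 0 (by omega) hES (by
        intro x hx
        obtain ⟨j, hj⟩ := hE x hx
        exact ⟨j, Or.inl hj⟩)
      rw [hEc] at this
      omega
    have F : ∀ t j, t + 2 ≤ 3 * c → phi n q t j ∈ S := by
      intro t j h2
      by_cases ht2 : t = 3 * c - 2
      · rw [ht2, ← hS]
        exact full_top2 (by omega) hn hcq hA (by omega) (hAc 0 (by omega)) j
      obtain h | h | h | h : t = 0 ∨ t = 1 ∨ t = 2 ∨ 3 ≤ t := by omega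
      · rw [h, ← hS]; exact full_zero (by omega) hn hcq hA (by omega) j
      · rw [h, ← hS]; exact full_one (by omega) hn hcq hA (by omega) j
      · rw [h, ← hS]; exact full_two (by omega) hn hcq hA (by omega) j
      · exact mid t j h (by omega)
    by_cases hk : k = 1
    · have := gen ∅ 0 (3 * c - 1) (fun t j h1 h2 => F t j (by omega)) (by simp) (by simp)
      simp only [card_empty, add_zero] at this
      have e : (3 * c - 1) * d = 3 * (c * d) - d := by rw [Nat.sub_mul]; ring_nf
      have e2 : d ∣ m - 1 := ⟨c, by rw [mul_comm d c]; omega⟩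
      rcases this with h | h
      · exact Or.inl h
      · right; right; right; right
        exact ⟨e2, by omega⟩
    · have := gen E 0 (3 * c) (fun t j h1 h2 => by
        by_cases ht2 : t = 3 * c - 1
        · rw [ht2, ← hS]
          exact full_top1 (by omega) hn hcq hA (by omega) (hAc 0 (by omega)) (hAc 1 (by omega)) j
        · exact F t j (by omega)) hES (by
        intro x hx
        obtain ⟨j, hj⟩ := hE x hx
        exact ⟨j, Or.inl (by simpa using hj)⟩)
      rw [hEc, mul_assoc] at this
      omega

theorem upper_rep {n m d q c k : ℕ} (hd : 0 < d) (hn : n = q * d) (hmn : m ≤ n)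
    (hk1 : 1 ≤ k) (hkd : k ≤ d) (hmk : m = c * d + k) (X : ZMod n)
    (hX : X ∈ hFoldRSum 3 (Aset n m d)) :
    ∃ a x b y e z, x < d ∧ y < d ∧ z < d ∧ a ≤ c ∧ b ≤ c ∧ e ≤ c ∧ (a = c → x < k) ∧
      (b = c → y < k) ∧ (e = c → z < k) ∧ (a = b → x ≠ y) ∧ (a = e → x ≠ z) ∧ (b = e → y ≠ z) ∧
      X = phi n q (a + b + e) (x + y + z) := by
  obtain ⟨-, -, -, -, h⟩ := A_props hd hn hmn hk1 hkd hmk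
  rw [mem_R] at hX
  obtain ⟨u, hu, v, hv, w, hw, h1, h2, h3, rfl⟩ := hX
  obtain ⟨a, x, hx, ha, hax, rfl⟩ := h u hu
  obtain ⟨b, y, hy, hb, hby, rfl⟩ := h v hv
  obtain ⟨e, z, hz, he, hez, rfl⟩ := h w hw
  refine ⟨a, x, b, y, e, z, hx, hy, hz, ha, hb, he, hax, hby, hez, ?_, ?_, ?_, ?_⟩
  · rintro rfl rfl; exact h1 rfl
  · rintro rfl rfl; exact h2 rfl
  · rintro rfl rfl; exact h3 rfl
  · rw [phi_add, phi_add]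

theorem upper_fd {n m d q : ℕ} (hd : 0 < d) (hn : n = q * d) (hm : 4 ≤ m) (hmn : m ≤ n) :
    (hFoldRSum 3 (Aset n m d)).card ≤ fd m 3 d := by
  obtain ⟨c, k, hk1, hkd, hmk⟩ := exists_ck m d hd (by omega)
  rw [fd_eq hk1 hkd hmk]
  have := upper_gen hn hd (hFoldRSum 3 (Aset n m d)) ∅ 0 (3 * c + 1) (by
    intro X hX
    obtain ⟨a, x, b, y, e, z, hx, hy, hz, ha, hb, he, -, -, -, -, -, -, rfl⟩ :=
      upper_rep hd hn hmn hk1 hkd hmk X hX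
    exact Or.inr ⟨_, _, by omega, by omega, rfl⟩)
  simpa using this

theorem upper_one {n m : ℕ} (hm : 4 ≤ m) (hmn : m ≤ n) :
    (hFoldRSum 3 (Aset n m 1)).card ≤ 3 * m - 8 := by
  have hn : n = n * 1 := by omega
  obtain ⟨c, k, hk1, hkd, hmk⟩ := exists_ck m 1 one_pos (by omega)
  have := upper_gen hn one_pos (hFoldRSum 3 (Aset n m 1)) ∅ 3 (3 * m - 8) (by
    intro X hX
    obtain ⟨a, x, b, y, e, z, hx, hy, hz, ha, hb, he, -, -, -, h1, h2, h3, rfl⟩ :=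
      upper_rep one_pos hn hmn hk1 hkd hmk X hX
    exact Or.inr ⟨_, _, by omega, by omega, rfl⟩)
  simpa using this

theorem upper_three {n m q : ℕ} (hm : 4 ≤ m) (hmn : m ≤ n) (hn : n = q * 3) (h3 : 3 ∣ m) :
    (hFoldRSum 3 (Aset n m 3)).card ≤ 3 * m - 10 := by
  obtain ⟨c, k, hk1, hkd, hmk⟩ := exists_ck m 3 (by omega) (by omega)
  have := upper_gen hn (by omega) (hFoldRSum 3 (Aset n m 3))
    {phi n q 0 3, phi n q (3 * c) 3} 1 (3 * c - 1) (by
    intro X hX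
    obtain ⟨a, x, b, y, e, z, hx, hy, hz, ha, hb, he, -, -, -, h1, h2, h3, rfl⟩ :=
      upper_rep (by omega) hn hmn hk1 hkd hmk X hX
    by_cases g0 : a + b + e = 0
    · left
      have : x + y + z = 3 := by
        have := h1 (by omega)
        have := h2 (by omega)
        have := h3 (by omega)
        omega
      rw [g0, this]; simp
    by_cases g1 : a + b + e = 3 * c
    · left
      have : x + y + z = 3 := by
        have := h1 (by omega)
        have := h2 (by omega)
        have := h3 (by omega)
        omega
      rw [g1, this]; simp
    exact Or.inr ⟨_, _, by omega, by omega, rfl⟩)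
  have h2 := card_le_two (a := phi n q 0 3) (b := phi n q (3 * c) 3)
  omega

theorem upper_gcd {n m d q : ℕ} (hd : 0 < d) (hm : 4 ≤ m) (hmn : m ≤ n) (hn : n = q * d)
    (h : d ∣ m - 1) :
    (hFoldRSum 3 (Aset n m d)).card ≤ 3 * m - 3 - d := by
  obtain ⟨c, hc⟩ := h
  have hmk : m = c * d + 1 := by rw [mul_comm c d]; omega
  have hc1 : 1 ≤ c := by
    rcases Nat.eq_zero_or_pos c with h | h
    · subst h; omega
    · exact h
  have := upper_gen hn hd (hFoldRSum 3 (Aset n m d)) ∅ 0 (3 * c - 1) (by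
    intro X hX
    obtain ⟨a, x, b, y, e, z, hx, hy, hz, ha, hb, he, h1, h2, h3, h4, h5, h6, rfl⟩ :=
      upper_rep hd hn hmn le_rfl hd hmk X hX
    exact Or.inr ⟨_, _, by omega, by omega, rfl⟩)
  have e : (3 * c - 1) * d = 3 * (c * d) - d := by rw [Nat.sub_mul]; ring_nf
  simp only [card_empty] at this
  omega

theorem uHat_le {n m d : ℕ} (h : d ∣ n) (hd : 0 < d) :
    uHat n m 3 ≤ (hFoldRSum 3 (Aset n m d)).card := Nat.sInf_le ⟨d, h, hd, rfl⟩

theorem uFun_le {n m d : ℕ} (h : d ∣ n) (hd : 0 < d) : uFun n m 3 ≤ fd m 3 d :=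
  Nat.sInf_le ⟨d, h, hd, rfl⟩

theorem uHat_le_uFun {n m : ℕ} (hm : 4 ≤ m) (hmn : m ≤ n) : uHat n m 3 ≤ uFun n m 3 := by
  have hne : { k | ∃ d : ℕ, d ∣ n ∧ 0 < d ∧ k = fd m 3 d }.Nonempty :=
    ⟨_, 1, one_dvd _, one_pos, rfl⟩
  obtain ⟨d, ⟨q, hq⟩, hd, e⟩ := Nat.sInf_mem hne
  unfold uFun
  rw [e]
  exact (uHat_le ⟨q, hq⟩ hd).trans (upper_fd hd (by rw [hq, mul_comm]) hm hmn)

theorem uFun_le_n {n m : ℕ} (hm : 4 ≤ m) (hmn : m ≤ n) : uFun n m 3 ≤ n := by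
  have h1 := uFun_le (m := m) (dvd_refl n) (by omega)
  rw [fd_eq (c := 0) (k := m) (by omega) hmn (by omega)] at h1
  omega

theorem core (n m r : ℕ) (hm : 4 ≤ m) (hmn : m ≤ n) (h1 : r ≤ 3 * m - 8)
    (h2 : 3 ∣ n → 3 ∣ m → r ≤ 3 * m - 10)
    (h3 : ∀ d, d ∣ n → d ∣ m - 1 → r ≤ 3 * m - 3 - d) (h4 : uHat n m 3 ≤ r) :
    uHat n m 3 = min (uFun n m 3) r := by
  apply le_antisymm (le_min (uHat_le_uFun hm hmn) h4)
  have hne : { k | ∃ d : ℕ, d ∣ n ∧ 0 < d ∧ k = (hFoldRSum 3 (Aset n m d)).card }.Nonempty :=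
    ⟨_, 1, one_dvd _, one_pos, rfl⟩
  obtain ⟨d, ⟨q, hq⟩, hd, e⟩ := Nat.sInf_mem hne
  have e' : uHat n m 3 = (hFoldRSum 3 (Aset n m d)).card := e
  rw [e']
  have u1 := uFun_le_n hm hmn
  have u2 := uFun_le (m := m) ⟨q, hq⟩ hd
  rcases lower_main hd (by rw [hq, mul_comm]) hm hmn with h | h | h | ⟨hd3, h3m, h⟩ | ⟨hdm, h⟩
  · omega
  · omega
  · omega
  · have := h2 ⟨q, by rw [hq, hd3]⟩ h3m
    omega
  · have := h3 d ⟨q, hq⟩ hdm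
    omega

theorem stmt17 (n m : ℕ) (hm : 4 ≤ m) (hmn : m ≤ n) :
    (8 ≤ Nat.gcd n (m - 1) →
      uHat n m 3 = min (uFun n m 3) (3 * m - 3 - Nat.gcd n (m - 1))) ∧
    ((Nat.gcd n (m - 1) = 7 ∨ (Nat.gcd n (m - 1) ≤ 5 ∧ 3 ∣ n ∧ 3 ∣ m)) →
      uHat n m 3 = min (uFun n m 3) (3 * m - 10)) ∧
    (Nat.gcd n (m - 1) = 6 → uHat n m 3 = min (uFun n m 3) (3 * m - 9)) ∧
    ((¬ 8 ≤ Nat.gcd n (m - 1) ∧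
      ¬ (Nat.gcd n (m - 1) = 7 ∨ (Nat.gcd n (m - 1) ≤ 5 ∧ 3 ∣ n ∧ 3 ∣ m)) ∧
      Nat.gcd n (m - 1) ≠ 6) →
      uHat n m 3 = min (uFun n m 3) (3 * m - 8)) := by
  have hg1 : n.gcd (m - 1) ∣ n := Nat.gcd_dvd_left _ _
  have hg2 : n.gcd (m - 1) ∣ m - 1 := Nat.gcd_dvd_right _ _
  have hgpos : 0 < n.gcd (m - 1) := Nat.gcd_pos_of_pos_left _ (by omega)
  have hgd : ∀ d, d ∣ n → d ∣ m - 1 → d ≤ n.gcd (m - 1) := fun d h1 h2 =>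
    Nat.le_of_dvd hgpos (Nat.dvd_gcd h1 h2)
  have hgu : uHat n m 3 ≤ 3 * m - 3 - n.gcd (m - 1) := by
    obtain ⟨q, hq⟩ := hg1
    exact (uHat_le ⟨q, hq⟩ hgpos).trans
      (upper_gcd hgpos hm hmn (hq.trans (mul_comm _ _)) hg2)
  have h1u : uHat n m 3 ≤ 3 * m - 8 := (uHat_le (one_dvd _) one_pos).trans (upper_one hm hmn)
  have h3u : 3 ∣ n → 3 ∣ m → uHat n m 3 ≤ 3 * m - 10 := by
    rintro ⟨q, hq⟩ h
    exact (uHat_le ⟨q, hq⟩ (by omega)).trans (upper_three hm hmn (hq.trans (mul_comm _ _)) h)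
  generalize n.gcd (m - 1) = g at *
  refine ⟨fun h => ?_, fun h => ?_, fun h => ?_, fun h => ?_⟩
  · exact core n m _ hm hmn (by omega) (by omega)
      (fun d a b => by have := hgd d a b; omega) hgu
  · refine core n m _ hm hmn (by omega) (by omega)
      (fun d a b => by have := hgd d a b; omega) ?_
    rcases h with h | ⟨-, h, h'⟩
    · omega
    · exact h3u h h'
  · subst h
    exact core n m _ hm hmn (by omega) (by omega)
      (fun d a b => by have := hgd d a b; omega) (by omega)
  · refine core n m _ hm hmn (by omega) (by omega)
      (fun d a b => by have := hgd d a b; omega) h1u
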